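/- Let p ∈ (1,∞), α ∈ (−∞,1), and β ∈ ℝ, and let μ_1(dx) = x_d^{−α} dx on ℝ^d_+. The power weight ω_1(x) = x_d^β belongs to the Muckenhoupt class A_p(ℝ^d_+, μ_1), i.e. sup over ρ > 0 and x_0 ∈ closure(ℝ^d_+) of ( ⨍_{B_ρ^+(x_0)} y_d^β μ_1(dy) ) ( ⨍_{B_ρ^+(x_0)} y_d^{β/(1−p)} μ_1(dy) )^{p−1} is finite, if and only if β ∈ (α − 1, (1 − α)(p − 1)). -/

import Mathlib

open MeasureTheory Real Set Filter

noncomputable section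

/-- Spatial points of the (upper half) space `ℝ^{d-1} × ℝ`, written `x = (x', x_d)`.
Here `n = d - 1`. -/
abbrev Pt (n : ℕ) := (Fin n → ℝ) × ℝ

/-- Space-time points `z = (t, x)`. -/
abbrev Zt (n : ℕ) := ℝ × Pt n

/-- Index set for the `d = n + 1` coordinate directions; `none` is the `d`-th (vertical)
direction. -/
abbrev Idx (n : ℕ) := Option (Fin n)

/-- The coordinate basis vectors of `Pt n`. -/
def ev (n : ℕ) : Idx n → Pt n
  | some i => (Pi.single i 1, 0)
  | none => (0, 1)

/-- Squared Euclidean distance on `Pt n`. -/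
def dE2 (n : ℕ) (x y : Pt n) : ℝ := (∑ i, (x.1 i - y.1 i) ^ 2) + (x.2 - y.2) ^ 2

/-- The open upper half space `ℝ^d_+`. -/
def uH (n : ℕ) : Set (Pt n) := {x | 0 < x.2}

/-- The closed upper half space. -/
def uHcl (n : ℕ) : Set (Pt n) := {x | 0 ≤ x.2}

/-- Upper half (Euclidean) ball `B_ρ^+(x₀)`. -/
def Bp (n : ℕ) (x0 : Pt n) (ρ : ℝ) : Set (Pt n) := {x | 0 < x.2 ∧ dE2 n x x0 < ρ ^ 2}

/-- Upper half parabolic cylinder `Q_ρ^+(z₀)`. -/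
def Qp (n : ℕ) (z0 : Zt n) (ρ : ℝ) : Set (Zt n) :=
  {z | z0.1 - ρ ^ 2 < z.1 ∧ z.1 < z0.1 ∧ 0 < z.2.2 ∧ dE2 n z.2 z0.2 < ρ ^ 2}

/-- The flat bottom face `Q_ρ(z₀) ∩ {x_d = 0}`. -/
def Qface (n : ℕ) (z0 : Zt n) (ρ : ℝ) : Set (Zt n) :=
  {z | z0.1 - ρ ^ 2 < z.1 ∧ z.1 < z0.1 ∧ z.2.2 = 0 ∧ dE2 n z.2 z0.2 < ρ ^ 2}

/-- The cylinder `Q_ρ(z₀) ∩ {x_d ≥ 0}`. -/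
def Qcl (n : ℕ) (z0 : Zt n) (ρ : ℝ) : Set (Zt n) :=
  {z | z0.1 - ρ ^ 2 < z.1 ∧ z.1 < z0.1 ∧ 0 ≤ z.2.2 ∧ dE2 n z.2 z0.2 < ρ ^ 2}

/-- Times `t < T` (with `T ∈ (-∞, ∞]` an extended real). -/
def Tset (T : EReal) : Set ℝ := {t | (t : EReal) < T}

/-- The space-time domain `Ω_T = (-∞, T) × ℝ^d_+`. -/
def Om (n : ℕ) (T : EReal) : Set (Zt n) := {z | (z.1 : EReal) < T ∧ 0 < z.2.2}

/-- `(-∞, T) × closure(ℝ^d_+)`. -/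
def OmCl (n : ℕ) (T : EReal) : Set (Zt n) := {z | (z.1 : EReal) < T ∧ 0 ≤ z.2.2}

/-! ### Derivatives (space-time functions) -/

/-- Spatial directional derivative `D_v u` of `u : Zt n → ℝ`. -/
def Ds (n : ℕ) (u : Zt n → ℝ) (v : Pt n) (z : Zt n) : ℝ :=
  fderiv ℝ (fun y => u (z.1, y)) z.2 v

/-- Spatial second derivative `D_v D_w u` of `u : Zt n → ℝ`. -/
def Ds2 (n : ℕ) (u : Zt n → ℝ) (v w : Pt n) (z : Zt n) : ℝ :=
  fderiv ℝ (fun y => fderiv ℝ (fun y' => u (z.1, y')) y w) z.2 v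

/-- Time derivative `u_t`. -/
def Dt (n : ℕ) (u : Zt n → ℝ) (z : Zt n) : ℝ := deriv (fun s => u (s, z.2)) z.1

/-- Iterated time derivative `∂_t^j u`. -/
def DtIter (n : ℕ) : ℕ → (Zt n → ℝ) → Zt n → ℝ
  | 0, u => u
  | j + 1, u => Dt n (DtIter n j u)

/-- Iterated tangential derivative `D_{x'}^k u` in the directions `m 0, …, m (k-1)`. -/
def DsIter (n : ℕ) : (k : ℕ) → (Fin k → Fin n) → (Zt n → ℝ) → Zt n → ℝ
  | 0, _, u => u
  | k + 1, m, u => Ds n (DsIter n k (fun i => m i.succ) u) (ev n (some (m 0)))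

/-- `|Du|²` (squared Euclidean length of the spatial gradient). -/
def gradSq (n : ℕ) (u : Zt n → ℝ) (z : Zt n) : ℝ := ∑ i : Idx n, (Ds n u (ev n i) z) ^ 2

/-- `|D D_{x'} u|²`: squared Euclidean length of the collection of second spatial
derivatives involving at least one tangential direction. -/
def ddxSq (n : ℕ) (u : Zt n → ℝ) (z : Zt n) : ℝ :=
  ∑ i : Fin n, ∑ j : Idx n, (Ds2 n u (ev n (some i)) (ev n j) z) ^ 2

/-- The weighted vertical second-order quantity `D_d (x_d^α D_d u)`. -/
def ddA (n : ℕ) (α : ℝ) (u : Zt n → ℝ) (z : Zt n) : ℝ :=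
  deriv (fun s => s ^ α * Ds n u (ev n none) (z.1, (z.2.1, s))) z.2.2

/-- Spatial Laplacian. -/
def lapP (n : ℕ) (u : Zt n → ℝ) (z : Zt n) : ℝ :=
  ∑ i : Idx n, Ds2 n u (ev n i) (ev n i) z

/-- The non-divergence form operator
`ℒu = a₀ u_t - a_{ij} D_{ij} u - (α/x_d) a_{dj} D_j u + λ c u`. -/
def opL (n : ℕ) (α lam : ℝ) (a : Zt n → Idx n → Idx n → ℝ) (a0 c : Zt n → ℝ)
    (u : Zt n → ℝ) (z : Zt n) : ℝ :=
  a0 z * Dt n u z - (∑ i : Idx n, ∑ j : Idx n, a z i j * Ds2 n u (ev n i) (ev n j) z)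
    - (α / z.2.2) * (∑ j : Idx n, a z none j * Ds n u (ev n j) z) + lam * c z * u z

/-! ### Measures and weights -/

/-- The space-time measure `μ₁(dz) = x_d^{-α} dx dt`. -/
def m1 (n : ℕ) (α : ℝ) : Measure (Zt n) :=
  volume.withDensity fun z => ENNReal.ofReal (z.2.2 ^ (-α))

/-- The spatial measure `μ₁(dx) = x_d^{-α} dx`. -/
def m1x (n : ℕ) (α : ℝ) : Measure (Pt n) :=
  volume.withDensity fun x => ENNReal.ofReal (x.2 ^ (-α))

/-- Uniform ellipticity and boundedness with constant `ν` at a point. -/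
def Ellip (n : ℕ) (ν : ℝ) (A : Idx n → Idx n → ℝ) : Prop :=
  (∀ ξ : Idx n → ℝ, ν * ∑ i, ξ i ^ 2 ≤ ∑ i, ∑ j, A i j * ξ i * ξ j) ∧
    ∀ i j, |A i j| ≤ ν⁻¹

/-- The structural condition `a_{dd} = 1`, `a_{dj} = 0` for `j < d`. -/
def StructCond (n : ℕ) (A : Idx n → Idx n → ℝ) : Prop :=
  A none none = 1 ∧ ∀ j : Fin n, A none (some j) = 0

/-- Average `[g]_{ρ,z₀}(s)` of `g(·, ·, s)` over `Q'_ρ(z₀')`. -/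
def slAvg (n : ℕ) (g : Zt n → ℝ) (z0 : Zt n) (ρ s : ℝ) : ℝ :=
  ⨍ w in (Set.Ioo (z0.1 - ρ ^ 2) z0.1) ×ˢ
      {y : Fin n → ℝ | (∑ i, (y i - z0.2.1 i) ^ 2) < ρ ^ 2},
    g (w.1, (w.2, s)) ∂volume

/-- The partial weighted mean oscillation `a^#_ρ(z₀)` of the coefficients. -/
def aSh (n : ℕ) (α : ℝ) (a : Zt n → Idx n → Idx n → ℝ) (a0 c : Zt n → ℝ)
    (ρ : ℝ) (z0 : Zt n) : ℝ :=
  (⨆ i : Idx n, ⨆ j : Idx n,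
    ⨍ z in Qp n z0 ρ, |a z i j - slAvg n (fun w => a w i j) z0 ρ z.2.2| ∂(m1 n α)) +
  ⨍ z in Qp n z0 ρ,
    (|a0 z - slAvg n a0 z0 ρ z.2.2| + |c z - slAvg n c z0 ρ z.2.2|) ∂(m1 n α)

/-- `A_q(ℝ)` Muckenhoupt bound `[w]_{A_q} ≤ K` (with the implicit local integrability). -/
def AqB (q K : ℝ) (w : ℝ → ℝ) : Prop :=
  ∀ t0 ρ : ℝ, 0 < ρ →
    IntegrableOn w (Set.Ioo (t0 - ρ) (t0 + ρ)) ∧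
    IntegrableOn (fun t => w t ^ (1 / (1 - q))) (Set.Ioo (t0 - ρ) (t0 + ρ)) ∧
    (⨍ t in Set.Ioo (t0 - ρ) (t0 + ρ), w t ∂volume) *
      (⨍ t in Set.Ioo (t0 - ρ) (t0 + ρ), w t ^ (1 / (1 - q)) ∂volume) ^ (q - 1) ≤ K

/-- `A_p(ℝ^d_+, μ₁)` Muckenhoupt bound `[w]_{A_p(ℝ^d_+, μ₁)} ≤ K`. -/
def ApB (n : ℕ) (α p K : ℝ) (w : Pt n → ℝ) : Prop :=
  ∀ x0 : Pt n, 0 ≤ x0.2 → ∀ ρ : ℝ, 0 < ρ →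
    IntegrableOn w (Bp n x0 ρ) (m1x n α) ∧
    IntegrableOn (fun x => w x ^ (1 / (1 - p))) (Bp n x0 ρ) (m1x n α) ∧
    (⨍ x in Bp n x0 ρ, w x ∂(m1x n α)) *
      (⨍ x in Bp n x0 ρ, w x ^ (1 / (1 - p)) ∂(m1x n α)) ^ (p - 1) ≤ K

/-! ### Mixed-norm and unmixed Lebesgue/Sobolev membership -/

/-- Inner (spatial) integral of the mixed norm, with spatial weight `W`. -/
def inIntg (n : ℕ) (p : ℝ) (D : Set (Pt n)) (W : Pt n → ℝ) (g : Zt n → ℝ) (t : ℝ) : ℝ :=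
  ∫ x in D, |g (t, x)| ^ p * W x

/-- Weighted mixed norm `‖g‖_{L_{q,p}((S × D), w₀(t) W(x) dx dt)}`. -/
def mxN (n : ℕ) (q p : ℝ) (S : Set ℝ) (D : Set (Pt n)) (w0 : ℝ → ℝ) (W : Pt n → ℝ)
    (g : Zt n → ℝ) : ℝ :=
  (∫ t in S, inIntg n p D W g t ^ (q / p) * w0 t) ^ (1 / q)

/-- Membership in the weighted mixed-norm Lebesgue space. -/
def MemMx (n : ℕ) (q p : ℝ) (S : Set ℝ) (D : Set (Pt n)) (w0 : ℝ → ℝ) (W : Pt n → ℝ)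
    (g : Zt n → ℝ) : Prop :=
  (∀ᵐ t ∂(volume.restrict S), IntegrableOn (fun x => |g (t, x)| ^ p * W x) D) ∧
  IntegrableOn (fun t => inIntg n p D W g t ^ (q / p) * w0 t) S

/-- Membership in the mixed-norm parabolic Sobolev space `𝕎^{1,2}_{q,p}` with spatial
weight `W = x_d^{pα} ω₁ x_d^{-α}` (so that `D_d(x_d^α D_d u)` carries weight `W x_d^{-pα}`). -/
def MemW (n : ℕ) (α q p : ℝ) (S : Set ℝ) (D : Set (Pt n)) (w0 : ℝ → ℝ) (W : Pt n → ℝ)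
    (u : Zt n → ℝ) : Prop :=
  MemMx n q p S D w0 W u ∧
  (∀ i : Idx n, MemMx n q p S D w0 W (Ds n u (ev n i))) ∧
  MemMx n q p S D w0 W (Dt n u) ∧
  (∀ i : Fin n, ∀ j : Idx n, MemMx n q p S D w0 W (Ds2 n u (ev n (some i)) (ev n j))) ∧
  MemMx n q p S D w0 (fun x => W x * x.2 ^ (-(p * α))) (ddA n α u)

/-- Variant with a genuinely space-time dependent weight `W(t,x)`. -/
def inIntg2 (n : ℕ) (p : ℝ) (D : Set (Pt n)) (W : Zt n → ℝ) (g : Zt n → ℝ) (t : ℝ) : ℝ :=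
  ∫ x in D, |g (t, x)| ^ p * W (t, x)

def mxN2 (n : ℕ) (q p : ℝ) (S : Set ℝ) (D : Set (Pt n)) (W : Zt n → ℝ) (g : Zt n → ℝ) : ℝ :=
  (∫ t in S, inIntg2 n p D W g t ^ (q / p)) ^ (1 / q)

def MemMx2 (n : ℕ) (q p : ℝ) (S : Set ℝ) (D : Set (Pt n)) (W : Zt n → ℝ) (g : Zt n → ℝ) :
    Prop :=
  (∀ᵐ t ∂(volume.restrict S), IntegrableOn (fun x => |g (t, x)| ^ p * W (t, x)) D) ∧
  IntegrableOn (fun t => inIntg2 n p D W g t ^ (q / p)) S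

def MemWmx2 (n : ℕ) (α q p : ℝ) (S : Set ℝ) (D : Set (Pt n)) (W : Zt n → ℝ)
    (u : Zt n → ℝ) : Prop :=
  MemMx2 n q p S D W u ∧
  (∀ i : Idx n, MemMx2 n q p S D W (Ds n u (ev n i))) ∧
  MemMx2 n q p S D W (Dt n u) ∧
  (∀ i : Fin n, ∀ j : Idx n, MemMx2 n q p S D W (Ds2 n u (ev n (some i)) (ev n j))) ∧
  MemMx2 n q p S D (fun z => W z * z.2.2 ^ (-(p * α))) (ddA n α u)

/-- Unmixed weighted `L_p` membership over a space-time region. -/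
def MemL (n : ℕ) (p : ℝ) (Q : Set (Zt n)) (W : Zt n → ℝ) (g : Zt n → ℝ) : Prop :=
  IntegrableOn (fun z => |g z| ^ p * W z) Q

/-- Unmixed weighted `L_p` norm over a space-time region. -/
def nrm (n : ℕ) (p : ℝ) (Q : Set (Zt n)) (W : Zt n → ℝ) (g : Zt n → ℝ) : ℝ :=
  (∫ z in Q, |g z| ^ p * W z) ^ (1 / p)

/-- Unmixed weighted parabolic Sobolev membership `u ∈ 𝕎^{1,2}_p(Q, W dz)` (the quantity
`D_d(x_d^α D_d u)` carries the weight `W x_d^{-pα}`). -/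
def MemW12 (n : ℕ) (α p : ℝ) (Q : Set (Zt n)) (W : Zt n → ℝ) (u : Zt n → ℝ) : Prop :=
  MemL n p Q W u ∧ (∀ i : Idx n, MemL n p Q W (Ds n u (ev n i))) ∧
  MemL n p Q W (Dt n u) ∧
  (∀ i : Fin n, ∀ j : Idx n, MemL n p Q W (Ds2 n u (ev n (some i)) (ev n j))) ∧
  MemL n p Q (fun z => W z * z.2.2 ^ (-(p * α))) (ddA n α u)

/-! ### The vector quantity `U = x_d^α (u_t, D D_{x'} u, √λ Du, λ u)` -/

abbrev UIx (n : ℕ) := (Unit ⊕ Fin n × Idx n) ⊕ (Idx n ⊕ Unit)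

def Uv (n : ℕ) (α lam : ℝ) (u : Zt n → ℝ) (z : Zt n) : UIx n → ℝ := fun i =>
  z.2.2 ^ α *
    match i with
    | Sum.inl (Sum.inl _) => Dt n u z
    | Sum.inl (Sum.inr (i, j)) => Ds2 n u (ev n (some i)) (ev n j) z
    | Sum.inr (Sum.inl j) => Real.sqrt lam * Ds n u (ev n j) z
    | Sum.inr (Sum.inr _) => lam * u z

/-- `|U|`. -/
def UvN (n : ℕ) (α lam : ℝ) (u : Zt n → ℝ) (z : Zt n) : ℝ :=
  Real.sqrt (∑ i, (Uv n α lam u z i) ^ 2)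

/-- Mean oscillation `⨍_Q |U - (U)_Q| dμ₁` of the vector `U` over `Q`. -/
def Uosc (n : ℕ) (α lam : ℝ) (u : Zt n → ℝ) (Q : Set (Zt n)) : ℝ :=
  ⨍ z in Q,
    Real.sqrt (∑ i, (Uv n α lam u z i - ⨍ w in Q, Uv n α lam u w i ∂(m1 n α)) ^ 2)
    ∂(m1 n α)

/-! ### Elliptic (time-independent) versions -/

def D1E (n : ℕ) (u : Pt n → ℝ) (v x : Pt n) : ℝ := fderiv ℝ u x v

def D2E (n : ℕ) (u : Pt n → ℝ) (v w x : Pt n) : ℝ :=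
  fderiv ℝ (fun y => fderiv ℝ u y w) x v

def gradSqE (n : ℕ) (u : Pt n → ℝ) (x : Pt n) : ℝ := ∑ i : Idx n, (D1E n u (ev n i) x) ^ 2

def ddxSqE (n : ℕ) (u : Pt n → ℝ) (x : Pt n) : ℝ :=
  ∑ i : Fin n, ∑ j : Idx n, (D2E n u (ev n (some i)) (ev n j) x) ^ 2

def lapE (n : ℕ) (u : Pt n → ℝ) (x : Pt n) : ℝ := ∑ i : Idx n, D2E n u (ev n i) (ev n i) x

def ddAE (n : ℕ) (α : ℝ) (u : Pt n → ℝ) (x : Pt n) : ℝ :=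
  deriv (fun s => s ^ α * D1E n u (ev n none) (x.1, s)) x.2

/-- The elliptic operator `𝓛u = -a_{ij} D_{ij} u - (α/x_d) a_{dj} D_j u + λ c u`. -/
def opLE (n : ℕ) (α lam : ℝ) (a : Pt n → Idx n → Idx n → ℝ) (c : Pt n → ℝ)
    (u : Pt n → ℝ) (x : Pt n) : ℝ :=
  -(∑ i : Idx n, ∑ j : Idx n, a x i j * D2E n u (ev n i) (ev n j) x)
    - (α / x.2) * (∑ j : Idx n, a x none j * D1E n u (ev n j) x) + lam * c x * u x

/-- `[g]_{ρ,x₀}(s)`: average of `g(·, s)` over the tangential ball `B'_ρ(x₀')`. -/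
def slAvgE (n : ℕ) (g : Pt n → ℝ) (x0 : Pt n) (ρ s : ℝ) : ℝ :=
  ⨍ y in {y : Fin n → ℝ | (∑ i, (y i - x0.1 i) ^ 2) < ρ ^ 2}, g (y, s) ∂volume

/-- Elliptic partial weighted mean oscillation `a^#_ρ(x₀)`. -/
def aShE (n : ℕ) (α : ℝ) (a : Pt n → Idx n → Idx n → ℝ) (c : Pt n → ℝ)
    (ρ : ℝ) (x0 : Pt n) : ℝ :=
  (⨆ i : Idx n, ⨆ j : Idx n,
    ⨍ x in Bp n x0 ρ, |a x i j - slAvgE n (fun w => a w i j) x0 ρ x.2| ∂(m1x n α)) +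
  ⨍ x in Bp n x0 ρ, |c x - slAvgE n c x0 ρ x.2| ∂(m1x n α)

def MemLE (n : ℕ) (p : ℝ) (D : Set (Pt n)) (W : Pt n → ℝ) (g : Pt n → ℝ) : Prop :=
  IntegrableOn (fun x => |g x| ^ p * W x) D

def nrmE (n : ℕ) (p : ℝ) (D : Set (Pt n)) (W : Pt n → ℝ) (g : Pt n → ℝ) : ℝ :=
  (∫ x in D, |g x| ^ p * W x) ^ (1 / p)

/-- Elliptic weighted Sobolev membership `u ∈ 𝕎^2_p(D, W dx)`. -/
def MemW2E (n : ℕ) (α p : ℝ) (D : Set (Pt n)) (W : Pt n → ℝ) (u : Pt n → ℝ) : Prop :=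
  MemLE n p D W u ∧ (∀ i : Idx n, MemLE n p D W (D1E n u (ev n i))) ∧
  (∀ i : Fin n, ∀ j : Idx n, MemLE n p D W (D2E n u (ev n (some i)) (ev n j))) ∧
  MemLE n p D (fun x => W x * x.2 ^ (-(p * α))) (ddAE n α u)

/-! ### Power weights on half balls -/

theorem mul_rpow_le_rpow_and_le {k M t : ℝ} (γ : ℝ) (hk : 0 < k) (hM : 0 < M)
    (h1 : k * M ≤ t) (h2 : t ≤ M) :
    k ^ |γ| * M ^ γ ≤ t ^ γ ∧ t ^ γ ≤ k ^ (-|γ|) * M ^ γ := by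
  have ht : 0 < t := lt_of_lt_of_le (by positivity) h1
  obtain ⟨u, rfl⟩ : ∃ u, t = u * M := ⟨t / M, by field_simp⟩
  have hku : k ≤ u := le_of_mul_le_mul_right h1 hM
  have hu1 : u ≤ 1 := by
    by_contra! h
    nlinarith
  have hu : 0 < u := hk.trans_le hku
  rw [mul_rpow hu.le hM.le]
  constructor
  · gcongr
    exact (rpow_le_rpow hk.le hku (abs_nonneg γ)).trans
      (rpow_le_rpow_of_exponent_ge hu hu1 (le_abs_self γ))
  · gcongr
    exact (rpow_le_rpow_of_exponent_ge hu hu1 (neg_abs_le γ)).trans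
      (rpow_le_rpow_of_nonpos hk hku (by simp))

theorem measurableSet_Bp (n : ℕ) (x0 : Pt n) (ρ : ℝ) : MeasurableSet (Bp n x0 ρ) := by
  unfold Bp dE2
  apply MeasurableSet.inter
  · exact measurableSet_lt measurable_const measurable_snd
  · exact measurableSet_lt (f := fun x : Pt n =>
      (∑ i, (x.1 i - x0.1 i) ^ 2) + (x.2 - x0.2) ^ 2) (by fun_prop) measurable_const

theorem measurable_ofReal_snd_rpow (n : ℕ) (γ : ℝ) :
    Measurable fun x : Pt n => ENNReal.ofReal (x.2 ^ γ) := by fun_prop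

theorem Bp_subset_box {n : ℕ} {x0 : Pt n} {ρ : ℝ} (hρ : 0 < ρ) :
    Bp n x0 ρ ⊆ Metric.ball x0.1 ρ ×ˢ Ioo 0 (x0.2 + ρ) ∩ {x | x0.2 - ρ < x.2} := by
  rintro x ⟨h0, h⟩
  unfold dE2 at h
  have hs : 0 ≤ ∑ i, (x.1 i - x0.1 i) ^ 2 := Finset.sum_nonneg fun i _ => sq_nonneg _
  have h2 : |x.2 - x0.2| < ρ := abs_lt_of_sq_lt_sq (by linarith) hρ.le
  rw [abs_lt] at h2
  refine ⟨⟨?_, h0, by linarith⟩, by simp only [mem_ofPred_eq]; linarith⟩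
  rw [Metric.mem_ball, dist_pi_lt_iff hρ]
  intro i
  have hi := Finset.single_le_sum (fun i _ => sq_nonneg (x.1 i - x0.1 i)) (Finset.mem_univ i)
  exact abs_lt_of_sq_lt_sq (by nlinarith [sq_nonneg (x.2 - x0.2)]) hρ.le

theorem box_subset_Bp {n : ℕ} {x0 : Pt n} {ρ : ℝ} (hx0 : 0 ≤ x0.2) (hρ : 0 < ρ) :
    Metric.ball x0.1 (ρ / (n + 1)) ×ˢ Ioo x0.2 (x0.2 + ρ / (n + 1)) ⊆ Bp n x0 ρ := by
  rintro x ⟨h1, h2, h3⟩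
  refine ⟨by linarith, ?_⟩
  unfold dE2
  have hδ : 0 < ρ / (n + 1) := by positivity
  rw [Metric.mem_ball, dist_pi_lt_iff hδ] at h1
  have hs : ∑ i, (x.1 i - x0.1 i) ^ 2 ≤ n * (ρ / (n + 1)) ^ 2 := by
    have := Finset.sum_le_card_nsmul Finset.univ (fun i => (x.1 i - x0.1 i) ^ 2)
      ((ρ / (n + 1)) ^ 2) fun i _ => sq_le_sq.2 (by
        rw [abs_of_pos hδ]
        exact (h1 i).le)
    simpa using this
  have h4 : (x.2 - x0.2) ^ 2 < (ρ / (n + 1)) ^ 2 := by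
    apply pow_lt_pow_left₀ <;> linarith
  have h5 : (n + 1) * (ρ / (n + 1)) ^ 2 ≤ ρ ^ 2 := by
    rw [div_pow, mul_div_assoc', div_le_iff₀ (by positivity)]
    nlinarith [mul_nonneg (sq_nonneg ρ) (n.cast_nonneg : (0 : ℝ) ≤ n),
      mul_nonneg (sq_nonneg ρ) (sq_nonneg (n : ℝ))]
  nlinarith

theorem lintegral_m1x_rpow {n : ℕ} (α γ : ℝ) {s : Set (Pt n)} (hs : MeasurableSet s)
    (hpos : ∀ x ∈ s, 0 < x.2) :
    ∫⁻ x in s, ENNReal.ofReal (x.2 ^ γ) ∂m1x n α =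
      ∫⁻ x in s, ENNReal.ofReal (x.2 ^ (γ - α)) := by
  rw [m1x, setLIntegral_withDensity_eq_setLIntegral_mul _ (measurable_ofReal_snd_rpow n _)
    (measurable_ofReal_snd_rpow n _) hs]
  refine setLIntegral_congr_fun hs fun x hx => ?_
  have hx2 := hpos x hx
  simp only [Pi.mul_apply]
  rw [← ENNReal.ofReal_mul (by positivity), ← rpow_add hx2, neg_add_eq_sub]

theorem lintegral_box_rpow {n : ℕ} (c : Fin n → ℝ) {r : ℝ} (hr : 0 < r) (I : Set ℝ) (e : ℝ) :
    ∫⁻ x in Metric.ball c r ×ˢ I, ENNReal.ofReal (x.2 ^ e) =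
      ENNReal.ofReal ((2 * r) ^ n) * ∫⁻ s in I, ENNReal.ofReal (s ^ e) := by
  have := lintegral_prod_mul (μ := volume.restrict (Metric.ball c r))
    (ν := volume.restrict I) (f := fun _ => 1) (g := fun s : ℝ => ENNReal.ofReal (s ^ e))
    (by fun_prop) (by fun_prop)
  simpa [Measure.prod_restrict, Real.volume_pi_ball c hr, Measure.volume_eq_prod] using this

theorem lintegral_Ioo_rpow {R e : ℝ} (hR : 0 < R) (he : -1 < e) :
    ∫⁻ s in Ioo 0 R, ENNReal.ofReal (s ^ e) = ENNReal.ofReal (R ^ (e + 1) / (e + 1)) := by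
  rw [← ofReal_integral_eq_lintegral_ofReal
    ((intervalIntegral.integrableOn_Ioo_rpow_iff hR).2 he)
    ((ae_restrict_iff' measurableSet_Ioo).2 (ae_of_all _ fun s hs => rpow_nonneg hs.1.le e)),
    ← integral_Ioc_eq_integral_Ioo, ← intervalIntegral.integral_of_le hR.le,
    integral_rpow (Or.inl he), zero_rpow (by linarith), sub_zero]

theorem lintegral_Bp_rpow_le {n : ℕ} {α γ : ℝ} (h : -1 < γ - α) {x0 : Pt n} (hx0 : 0 ≤ x0.2)
    {ρ : ℝ} (hρ : 0 < ρ) :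
    ∫⁻ x in Bp n x0 ρ, ENNReal.ofReal (x.2 ^ γ) ∂m1x n α ≤
      ENNReal.ofReal ((2 * ρ) ^ n * ((x0.2 + ρ) ^ (γ - α + 1) / (γ - α + 1))) := by
  rw [lintegral_m1x_rpow α γ (measurableSet_Bp n x0 ρ) fun x hx => hx.1,
    ENNReal.ofReal_mul (by positivity), ← lintegral_Ioo_rpow (by positivity) h,
    ← lintegral_box_rpow x0.1 hρ]
  exact lintegral_mono_set ((Bp_subset_box hρ).trans inter_subset_left)

theorem m1x_Bp_lt_top {n : ℕ} {α : ℝ} (hα : α < 1) {x0 : Pt n} (hx0 : 0 ≤ x0.2) {ρ : ℝ}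
    (hρ : 0 < ρ) : m1x n α (Bp n x0 ρ) < ⊤ := by
  have h := lintegral_Bp_rpow_le (γ := 0) (α := α) (by linarith) hx0 hρ
  simp only [rpow_zero, ENNReal.ofReal_one, setLIntegral_one] at h
  exact h.trans_lt ENNReal.ofReal_lt_top

theorem le_m1x_Bp {n : ℕ} {α : ℝ} {x0 : Pt n} (hx0 : 0 ≤ x0.2) {ρ : ℝ} (hρ : 0 < ρ)
    (hx : x0.2 ≤ 2 * ρ) :
    ENNReal.ofReal ((2 * (ρ / (n + 1))) ^ n *
      ((1 / (6 * (n + 1))) ^ |(-α)| * (x0.2 + ρ) ^ (-α) * (ρ / (n + 1) / 2))) ≤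
      m1x n α (Bp n x0 ρ) := by
  have hδ : 0 < ρ / (n + 1) := by positivity
  have hB := lintegral_m1x_rpow α 0 (measurableSet_Bp n x0 ρ) fun x hx => hx.1
  simp only [rpow_zero, ENNReal.ofReal_one, setLIntegral_one, zero_sub] at hB
  rw [hB]
  refine le_trans ?_ (lintegral_mono_set (box_subset_Bp hx0 hρ))
  rw [lintegral_box_rpow _ hδ, ENNReal.ofReal_mul (by positivity)]
  gcongr
  set J := Ioo (x0.2 + ρ / (n + 1) / 2) (x0.2 + ρ / (n + 1))
  have hJ : J ⊆ Ioo x0.2 (x0.2 + ρ / (n + 1)) := Ioo_subset_Ioo_left (by linarith)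
  refine le_trans ?_ (lintegral_mono_set hJ)
  have hv : volume J = ENNReal.ofReal (ρ / (n + 1) / 2) := by
    rw [Real.volume_Ioo]
    ring_nf
  rw [ENNReal.ofReal_mul (by positivity), ← hv, ← setLIntegral_const]
  refine setLIntegral_mono (by fun_prop) fun s hs => ENNReal.ofReal_le_ofReal ?_
  refine (mul_rpow_le_rpow_and_le (-α) (by positivity) (by positivity) ?_ ?_).1
  · have : 1 / (6 * (n + 1)) * (x0.2 + ρ) ≤ ρ / (n + 1) / 2 := by
      rw [div_div, div_mul_eq_mul_div, div_le_div_iff₀ (by positivity) (by positivity)]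
      nlinarith [mul_nonneg (sub_nonneg.2 hx) (by positivity : (0 : ℝ) ≤ n + 1)]
    linarith [hs.1]
  · have : ρ / (n + 1) ≤ ρ := div_le_self hρ.le (by simp)
    linarith [hs.2]

theorem exists_lintegral_Bp_rpow_le (n : ℕ) {α γ : ℝ} (h : -1 < γ - α) :
    ∃ C : ℝ, 0 ≤ C ∧ ∀ x0 : Pt n, 0 ≤ x0.2 → ∀ ρ : ℝ, 0 < ρ →
      ∫⁻ x in Bp n x0 ρ, ENNReal.ofReal (x.2 ^ γ) ∂m1x n α ≤
        ENNReal.ofReal (C * (x0.2 + ρ) ^ γ) * m1x n α (Bp n x0 ρ) := by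
  have h1 : 0 < γ - α + 1 := by linarith
  set k : ℝ := (1 / (6 * (n + 1))) ^ |(-α)| with hk
  have hk0 : 0 < k := by positivity
  set C₁ : ℝ := (1 / 3) ^ (-|γ|)
  set C₂ : ℝ := (n + 1) ^ n * (6 * (n + 1)) / (k * (γ - α + 1))
  have hC₁ : 0 ≤ C₁ := by positivity
  have hC₂ : 0 ≤ C₂ := by positivity
  refine ⟨max C₁ C₂, le_max_of_le_left hC₁, fun x0 hx0 ρ hρ => ?_⟩
  have hM : 0 < x0.2 + ρ := by positivity
  rcases le_total x0.2 (2 * ρ) with hx | hx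
  · refine (lintegral_Bp_rpow_le h hx0 hρ).trans (le_trans ?_
      (mul_le_mul_right (le_m1x_Bp hx0 hρ hx) _))
    rw [← ENNReal.ofReal_mul (by positivity), ← hk]
    apply ENNReal.ofReal_le_ofReal
    refine le_trans ?_ (mul_le_mul_of_nonneg_right
      (mul_le_mul_of_nonneg_right (le_max_right C₁ C₂) (by positivity)) (by positivity))
    have e1 : (x0.2 + ρ) ^ (γ - α + 1) =
        (x0.2 + ρ) ^ γ * (x0.2 + ρ) ^ (-α) * (x0.2 + ρ) := by
      rw [rpow_add hM, rpow_one, sub_eq_add_neg, rpow_add hM]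
    have e2 : C₂ * (x0.2 + ρ) ^ γ * ((2 * (ρ / (n + 1))) ^ n *
        (k * (x0.2 + ρ) ^ (-α) * (ρ / (n + 1) / 2))) =
        (2 * ρ) ^ n * ((x0.2 + ρ) ^ γ * (x0.2 + ρ) ^ (-α) * (3 * ρ) / (γ - α + 1)) := by
      simp only [C₂, mul_pow, div_pow]
      field_simp
      ring
    rw [e1, e2]
    gcongr
    linarith
  · rw [← setLIntegral_const]
    refine setLIntegral_mono measurable_const fun x hxB => ENNReal.ofReal_le_ofReal ?_
    obtain ⟨⟨-, -, hu⟩, hl⟩ := Bp_subset_box hρ hxB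
    simp only [mem_ofPred_eq] at hl
    exact (mul_rpow_le_rpow_and_le (k := 1 / 3) γ (by norm_num) hM (by linarith) hu.le).2.trans
      (by gcongr; exact le_max_left _ _)

theorem exists_setAverage_Bp_rpow_le (n : ℕ) {α γ : ℝ} (hα : α < 1) (h : -1 < γ - α) :
    ∃ C : ℝ, 0 ≤ C ∧ ∀ x0 : Pt n, 0 ≤ x0.2 → ∀ ρ : ℝ, 0 < ρ →
      IntegrableOn (fun x : Pt n => x.2 ^ γ) (Bp n x0 ρ) (m1x n α) ∧
      0 ≤ ⨍ x in Bp n x0 ρ, x.2 ^ γ ∂m1x n α ∧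
      ⨍ x in Bp n x0 ρ, x.2 ^ γ ∂m1x n α ≤ C * (x0.2 + ρ) ^ γ := by
  obtain ⟨C, hC, hle⟩ := exists_lintegral_Bp_rpow_le n h
  refine ⟨C, hC, fun x0 hx0 ρ hρ => ?_⟩
  have hfin := m1x_Bp_lt_top hα hx0 hρ
  have hB := hle x0 hx0 ρ hρ
  have hM : 0 < x0.2 + ρ := by positivity
  have hpos : 0 ≤ᵐ[(m1x n α).restrict (Bp n x0 ρ)] fun x : Pt n => x.2 ^ γ :=
    (ae_restrict_iff' (measurableSet_Bp n x0 ρ)).2 (ae_of_all _ fun x hx => rpow_nonneg hx.1.le γ)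
  have hmeas : AEStronglyMeasurable (fun x : Pt n => x.2 ^ γ)
      ((m1x n α).restrict (Bp n x0 ρ)) :=
    (show Measurable fun x : Pt n => x.2 ^ γ by fun_prop).aestronglyMeasurable
  have htop : ENNReal.ofReal (C * (x0.2 + ρ) ^ γ) * m1x n α (Bp n x0 ρ) ≠ ⊤ :=
    ENNReal.mul_ne_top ENNReal.ofReal_ne_top hfin.ne
  refine ⟨(lintegral_ofReal_ne_top_iff_integrable hmeas hpos).1 (ne_top_of_le_ne_top htop hB),
    ?_, ?_⟩
  · rw [setAverage_eq]
    exact smul_nonneg (by positivity) (integral_nonneg_of_ae hpos)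
  · rw [setAverage_eq, integral_eq_lintegral_of_nonneg_ae hpos hmeas, smul_eq_mul]
    have := ENNReal.toReal_mono htop hB
    rw [ENNReal.toReal_mul, ENNReal.toReal_ofReal (by positivity)] at this
    exact inv_mul_le_of_le_mul₀ measureReal_nonneg (by positivity)
      (this.trans_eq (mul_comm _ _))

theorem lt_of_integrableOn_Bp_rpow {n : ℕ} {α γ : ℝ}
    (h : IntegrableOn (fun x : Pt n => x.2 ^ γ) (Bp n 0 1) (m1x n α)) : -1 < γ - α := by
  have hδ : (0 : ℝ) < 1 / (n + 1) := by positivity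
  have hpos : 0 ≤ᵐ[(m1x n α).restrict (Bp n 0 1)] fun x : Pt n => x.2 ^ γ :=
    (ae_restrict_iff' (measurableSet_Bp n 0 1)).2 (ae_of_all _ fun x hx => rpow_nonneg hx.1.le γ)
  have hI := (lintegral_ofReal_ne_top_iff_integrable h.aestronglyMeasurable hpos).2 h
  rw [lintegral_m1x_rpow α γ (measurableSet_Bp n 0 1) fun x hx => hx.1] at hI
  have hbox := ne_top_of_le_ne_top hI
    (lintegral_mono_set (box_subset_Bp (x0 := (0 : Pt n)) le_rfl one_pos))
  rw [lintegral_box_rpow _ hδ] at hbox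
  simp only [Prod.snd_zero, zero_add] at hbox
  have hI2 : ∫⁻ s in Ioo (0 : ℝ) (1 / (n + 1)), ENNReal.ofReal (s ^ (γ - α)) ≠ ⊤ := fun ht => by
    rw [ht, ENNReal.mul_top (by positivity)] at hbox
    exact hbox rfl
  rw [← intervalIntegral.integrableOn_Ioo_rpow_iff hδ]
  refine (lintegral_ofReal_ne_top_iff_integrable
    (show Measurable fun s : ℝ => s ^ (γ - α) by fun_prop).aestronglyMeasurable
    ((ae_restrict_iff' measurableSet_Ioo).2
      (ae_of_all _ fun s hs => rpow_nonneg hs.1.le _))).1 hI2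

/-! ### Statement 16 -/

theorem statement_16 (n : ℕ) (p α β : ℝ) (hp : 1 < p) (hα : α < 1) :
    (∃ K : ℝ, ApB n α p K fun x : Pt n => x.2 ^ β) ↔
      α - 1 < β ∧ β < (1 - α) * (p - 1) := by
  have hp1 : 0 < p - 1 := by linarith
  have hdual : -1 < β * (1 / (1 - p)) - α ↔ β < (1 - α) * (p - 1) := by
    have e : β * (1 / (1 - p)) = -(β / (p - 1)) := by
      rw [mul_one_div, ← neg_sub p 1, div_neg]
    rw [← div_lt_iff₀ hp1, e]
    constructor <;> intro h <;> linarith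
  have hpow (x0 : Pt n) (ρ : ℝ) : EqOn (fun x : Pt n => (x.2 ^ β) ^ (1 / (1 - p)))
      (fun x => x.2 ^ (β * (1 / (1 - p)))) (Bp n x0 ρ) :=
    fun x hx => (rpow_mul hx.1.le _ _).symm
  constructor
  · rintro ⟨K, hK⟩
    obtain ⟨h1, h2, -⟩ := hK 0 le_rfl 1 one_pos
    rw [integrableOn_congr_fun (hpow 0 1) (measurableSet_Bp n 0 1)] at h2
    exact ⟨by linarith [lt_of_integrableOn_Bp_rpow h1], hdual.1 (lt_of_integrableOn_Bp_rpow h2)⟩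
  · rintro ⟨h1, h2⟩
    obtain ⟨C, hC, hw⟩ := exists_setAverage_Bp_rpow_le n hα (by linarith : -1 < β - α)
    obtain ⟨C', hC', hw'⟩ := exists_setAverage_Bp_rpow_le n hα (hdual.2 h2)
    refine ⟨C * C' ^ (p - 1), fun x0 hx0 ρ hρ => ?_⟩
    obtain ⟨i1, p1, l1⟩ := hw x0 hx0 ρ hρ
    obtain ⟨i2, p2, l2⟩ := hw' x0 hx0 ρ hρ
    have hM : 0 < x0.2 + ρ := by positivity
    refine ⟨i1, (integrableOn_congr_fun (hpow x0 ρ) (measurableSet_Bp n x0 ρ)).2 i2, ?_⟩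
    rw [setAverage_eq (m1x n α) (fun x : Pt n => (x.2 ^ β) ^ (1 / (1 - p))),
      setIntegral_congr_fun (measurableSet_Bp n x0 ρ) (hpow x0 ρ), ← setAverage_eq]
    calc _ ≤ C * (x0.2 + ρ) ^ β * (C' * (x0.2 + ρ) ^ (β * (1 / (1 - p)))) ^ (p - 1) := by gcongr
      _ = C * C' ^ (p - 1) * ((x0.2 + ρ) ^ β * (x0.2 + ρ) ^ (β * (1 / (1 - p)) * (p - 1))) := by
        rw [mul_rpow hC' (by positivity), ← rpow_mul hM.le]
        ring
      _ = C * C' ^ (p - 1) := by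
        have e : β * (1 / (1 - p)) * (p - 1) = -β := by
          rw [← neg_sub p 1]
          field_simp
        rw [e, ← rpow_add hM, add_neg_cancel, rpow_zero, mul_one]

end
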